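/- Let F be a finite field with q elements and let C ⊆ F^n be a linear subspace containing a nonzero vector, with minimum distance d := d(C). Then for every pair of linearly independent vectors u, v ∈ C, q·|supp(u) ∪ supp(v)| ≥ (q+1)·d. (That is, every subspace over a field with q elements is (1+1/q)-non-overlapping.) -/

import Mathlib

open Matrix

noncomputable section

/-- Hamming weight of a vector: number of nonzero coordinates. -/
def hw {F : Type*} [Zero F] {n : ℕ} (x : Fin n → F) : ℕ :=
  (Function.support x).ncard

/-- Minimum distance of a linear code. -/
def dmin {F : Type*} [Field F] {n : ℕ} (C : Submodule F (Fin n → F)) : ℕ :=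
  sInf {w | ∃ u ∈ C, u ≠ 0 ∧ hw u = w}

theorem Set.ncard_eq_sum_ite {n : ℕ} (s : Set (Fin n)) [DecidablePred (· ∈ s)] :
    s.ncard = ∑ i, if i ∈ s then 1 else 0 := by
  rw [Set.ncard_eq_toFinset_card', Finset.sum_boole, Nat.cast_id]
  congr 1
  ext i
  simp

theorem dmin_le_hw {F : Type*} [Field F] {n : ℕ} {C : Submodule F (Fin n → F)}
    {u : Fin n → F} (hu : u ∈ C) (hu0 : u ≠ 0) : dmin C ≤ hw u :=
  Nat.sInf_le ⟨u, hu, hu0, rfl⟩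

open Classical in
theorem sum_ite_add_mul_ne_zero_le {F : Type*} [Field F] [Fintype F] (a b : F) :
    (∑ t : F, if a + t * b ≠ 0 then 1 else 0) + (if b ≠ 0 then 1 else 0) ≤
      Fintype.card F * if a ≠ 0 ∨ b ≠ 0 then 1 else 0 := by
  by_cases hb : b = 0
  · by_cases ha : a = 0 <;> simp [ha, hb]
  · have hlt : (Finset.univ.filter fun t : F => a + t * b ≠ 0).card < Fintype.card F := by
      refine Finset.card_lt_univ_of_notMem (x := -a / b) ?_
      simp [hb]
    rw [Finset.sum_boole, Nat.cast_id, if_pos hb, if_pos (Or.inr hb), mul_one]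
    exact hlt

/-- The weights of the vectors `u + t v` and `v`, one for each line in the span of `u` and `v`,
add up to at most `q` times the size of the joint support. -/
theorem sum_hw_add_smul_add_hw_le {F : Type*} [Field F] [Fintype F] {n : ℕ} (u v : Fin n → F) :
    (∑ t : F, hw (u + t • v)) + hw v ≤
      Fintype.card F * (Function.support u ∪ Function.support v).ncard := by
  classical
  simp only [hw, Set.ncard_eq_sum_ite]
  rw [Finset.sum_comm, ← Finset.sum_add_distrib, Finset.mul_sum]
  refine Finset.sum_le_sum fun i _ => ?_
  simpa only [Set.mem_union, Function.mem_support, Pi.add_apply, Pi.smul_apply, smul_eq_mul]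
    using sum_ite_add_mul_ne_zero_le (u i) (v i)

theorem stmt3 {F : Type*} [Field F] [Fintype F] {q n : ℕ}
    (hq : Fintype.card F = q) (C : Submodule F (Fin n → F))
    (hC : ∃ u ∈ C, u ≠ 0)
    (u v : Fin n → F) (hu : u ∈ C) (hv : v ∈ C)
    (hind : LinearIndependent F ![u, v]) :
    (q + 1) * dmin C ≤ q * (Function.support u ∪ Function.support v).ncard := by
  have hv0 : v ≠ 0 := hind.ne_zero 1
  have hut (t : F) : u + t • v ≠ 0 := fun h =>
    one_ne_zero (LinearIndependent.pair_iff.mp hind 1 t (by rwa [one_smul])).1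
  calc (q + 1) * dmin C = (∑ _t : F, dmin C) + dmin C := by
        rw [Finset.sum_const, Finset.card_univ, hq, smul_eq_mul, add_one_mul]
    _ ≤ (∑ t : F, hw (u + t • v)) + hw v :=
        add_le_add
          (Finset.sum_le_sum fun t _ => dmin_le_hw (C.add_mem hu (C.smul_mem t hv)) (hut t))
          (dmin_le_hw hv hv0)
    _ ≤ q * (Function.support u ∪ Function.support v).ncard :=
        hq ▸ sum_hw_add_smul_add_hw_le u v
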